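/- Let K ≥ 1, C^1,…,C^K > 0, ℛ_s the simplex rate region, H^wc a quasi-continuous work-conserving max-weight scheduler, and μ ∈ ℝ₊^K with μ̂ := Σ_k μ^k/C^k < 1. Then the infinite-horizon workload map G^wc : 𝒟^K_μ → ℝ₊^K (well defined as the limit of the finite-horizon maps) is almost compact with respect to the scaled uniform metric on 𝒟^K_μ. -/

import Mathlib

open Filter Topology MeasureTheory
open scoped ENNReal NNReal

/-- The nonnegative orthant ℝ₊^K as a metric subspace of `Fin K → ℝ`
(the latter carrying the square/sup product metric, as in the paper). -/
abbrev Orth (K : ℕ) := {w : Fin K → ℝ // ∀ k, 0 ≤ w k}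

instance (K : ℕ) : Nonempty (Orth K) := ⟨⟨fun _ => 0, fun _ => le_rfl⟩⟩

/-- Euclidean inner product on `Fin K → ℝ`. -/
def ip {K : ℕ} (x y : Fin K → ℝ) : ℝ := ∑ k, x k * y k

/-- `F` is quasi-continuous at `x`: there is a sequence `xₙ → x` with `F xₙ → F x`
and `F` continuous at every `xₙ`. -/
def QuasiContinuousAt {X Y : Type*} [MetricSpace X] [MetricSpace Y] (F : X → Y) (x : X) : Prop :=
  ∃ u : ℕ → X, Tendsto u atTop (nhds x) ∧
    Tendsto (fun n => F (u n)) atTop (nhds (F x)) ∧ ∀ n, ContinuousAt F (u n)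

/-- `F` is quasi-continuous if it is quasi-continuous at every point. -/
def QuasiContinuous {X Y : Type*} [MetricSpace X] [MetricSpace Y] (F : X → Y) : Prop :=
  ∀ x, QuasiContinuousAt F x

/-- `F` is almost compact: along every convergent sequence in the domain there is a
subsequence on which `F` converges. -/
def AlmostCompact {X Y : Type*} [MetricSpace X] [MetricSpace Y] (F : X → Y) : Prop :=
  ∀ (x : X) (u : ℕ → X), Tendsto u atTop (nhds x) →
    ∃ (φ : ℕ → ℕ) (y : Y), StrictMono φ ∧ Tendsto (fun n => F (u (φ n))) atTop (nhds y)

/-- Componentwise positive part, landing in the nonnegative orthant. -/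
def posPart {K : ℕ} (w : Fin K → ℝ) : Orth K := ⟨fun k => max (w k) 0, fun k => le_max_right _ _⟩

def addO {K : ℕ} (a b : Orth K) : Orth K :=
  ⟨fun k => a.1 k + b.1 k, fun k => add_nonneg (a.2 k) (b.2 k)⟩

/-- The finite-horizon workload map under scheduler `H`, on the list of arrivals
`[a_1, …, a_t]` (`a_1` the most recent arrival):
`G_1(a_1) = a_1`, `G_t(a_1,…,a_t) = a_1 + [G_{t-1}(a_2,…,a_t) - H (G_{t-1}(a_2,…,a_t))]⁺`. -/
def GwcL {K : ℕ} (H : Orth K → Orth K) : List (Orth K) → Orth K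
  | [] => ⟨fun _ => 0, fun _ => le_rfl⟩
  | [a] => a
  | a :: b :: rest =>
      addO a (posPart ((GwcL H (b :: rest)).1 - (H (GwcL H (b :: rest))).1))

/-- The simplex rate region `ℛ_s = {r ∈ ℝ₊^K : ∑_k r^k / C^k ≤ 1}`. -/
def simplexRegion {K : ℕ} (C : Fin K → ℝ) : Set (Fin K → ℝ) :=
  {r | (∀ k, 0 ≤ r k) ∧ ∑ k, r k / C k ≤ 1}

/-- `H` is a work-conserving max-weight scheduler for rate region `R` with capacities `C`:
on `Π_k [0, C^k)` it is the (Euclidean) metric projection onto `R`, elsewhere it is a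
max-weight choice. -/
def IsWCScheduler {K : ℕ} (R : Set (Fin K → ℝ)) (C : Fin K → ℝ) (H : Orth K → Orth K) : Prop :=
  ∀ w : Orth K,
    ((∀ k, w.1 k < C k) →
      ((H w).1 ∈ R ∧ ∀ r ∈ R, ∑ k, (w.1 k - (H w).1 k) ^ 2 ≤ ∑ k, (w.1 k - r k) ^ 2)) ∧
    ((¬ ∀ k, w.1 k < C k) →
      ((H w).1 ∈ R ∧ ∀ r ∈ R, ip r w.1 ≤ ip (H w).1 w.1))

/-- The space 𝒟^K of nonnegative arrival sequences with bounded scaled partial sums;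
`f s k` is the work brought into queue `k` at time `-(s+1)` (i.e. the paper's `a^k_{s+1}`). -/
structure DK (K : ℕ) where
  f : ℕ → Fin K → ℝ
  nonneg : ∀ s k, 0 ≤ f s k
  bdd : ∀ k, BddAbove (Set.range fun t : ℕ => (∑ s ∈ Finset.range (t + 1), f s k) / (t + 1))

namespace DK

/-- Embedding of `DK K` into bounded functions via the scaled partial sums
`(t, k) ↦ a^k(0, t+1] / (t+1)`; the induced metric is the scaled uniform metric
`d(x,y) = sup_{t≥1} max_k |x^k(0,t] − y^k(0,t]| / t`. -/
noncomputable def emb {K : ℕ} (a : DK K) : BoundedContinuousFunction (ℕ × Fin K) ℝ :=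
  ⟨⟨fun p => (∑ s ∈ Finset.range (p.1 + 1), a.f s p.2) / (p.1 + 1),
    continuous_of_discreteTopology⟩, by
    classical
    choose M hM using fun k => (a.bdd k).imp (fun M hM => fun t =>
      hM (Set.mem_range_self t))
    refine ⟨∑ k : Fin K, |M k|, fun x y => ?_⟩
    have hb : ∀ p : ℕ × Fin K,
        (∑ s ∈ Finset.range (p.1 + 1), a.f s p.2) / (p.1 + 1) ∈
          Set.Icc (0 : ℝ) (∑ k : Fin K, |M k|) := by
      intro p
      constructor
      · exact div_nonneg (Finset.sum_nonneg fun s _ => a.nonneg s p.2) (by positivity)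
      · refine le_trans (hM p.2 p.1) (le_trans (le_abs_self _) ?_)
        exact Finset.single_le_sum (f := fun k => |M k|) (fun k _ => abs_nonneg _)
          (Finset.mem_univ p.2)
    have hx := hb x; have hy := hb y
    rw [Real.dist_eq, abs_sub_le_iff]
    constructor <;> linarith [hx.1, hx.2, hy.1, hy.2]⟩

theorem emb_injective {K : ℕ} : Function.Injective (emb (K := K)) := by
  intro a b h
  have hval : ∀ t : ℕ, ∀ k, (∑ s ∈ Finset.range (t + 1), a.f s k) / (t + 1)
      = (∑ s ∈ Finset.range (t + 1), b.f s k) / (t + 1) := by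
    intro t k
    exact congrArg (fun F : BoundedContinuousFunction (ℕ × Fin K) ℝ => F (t, k)) h
  have hsum : ∀ t : ℕ, ∀ k, (∑ s ∈ Finset.range t, a.f s k) = ∑ s ∈ Finset.range t, b.f s k := by
    intro t k
    cases t with
    | zero => simp
    | succ t =>
      have := hval t k
      have ht : ((t : ℝ) + 1) ≠ 0 := by positivity
      field_simp at this
      exact this
  have hf : a.f = b.f := by
    funext s k
    have h1 := hsum (s + 1) k
    have h2 := hsum s k
    rw [Finset.sum_range_succ, Finset.sum_range_succ] at h1
    linarith
  cases a; cases b; simp_all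

/-- The scaled uniform metric on 𝒟^K. -/
noncomputable instance {K : ℕ} : MetricSpace (DK K) :=
  MetricSpace.induced emb emb_injective inferInstance

end DK

/-- 𝒟^K_μ : arrival processes with long-run rate `μ`, as a metric subspace of 𝒟^K. -/
abbrev Dmu (K : ℕ) (μ : Fin K → ℝ) :=
  {a : DK K // ∀ k,
    Tendsto (fun t : ℕ => (∑ s ∈ Finset.range t, a.f s k) / t) atTop (nhds (μ k))}

/-- The finite restriction `a|_{(0,t]} = (a_1, …, a_t)`. -/
def restr {K : ℕ} (a : DK K) (t : ℕ) : Fin t → Orth K := fun i => ⟨a.f i, a.nonneg i⟩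

/-- The infinite-horizon workload `G^wc(a) := lim_{T→∞} G_T^wc(a|_{(0,T]})`. -/
noncomputable def Ginf {K : ℕ} (Hwc : Orth K → Orth K) {μ : Fin K → ℝ} (a : Dmu K μ) : Orth K :=
  limUnder atTop (fun T : ℕ => GwcL Hwc (List.ofFn (restr a.1 T)))

/-- The total workload `∑ k, w k / C k`, measured in units of service time. -/
noncomputable def totalWork {K : ℕ} (C w : Fin K → ℝ) : ℝ := ∑ k, w k / C k

theorem le_mul_totalWork {K : ℕ} {C : Fin K → ℝ} (hC : ∀ k, 0 < C k) (w : Orth K) (k : Fin K) :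
    w.1 k ≤ C k * totalWork C w.1 := by
  have h : w.1 k / C k ≤ totalWork C w.1 :=
    Finset.single_le_sum (f := fun k => w.1 k / C k)
      (fun k _ => div_nonneg (w.2 k) (hC k).le) (Finset.mem_univ k)
  rwa [div_le_iff₀ (hC k), mul_comm] at h

/-- A max-weight choice over the simplex uses the full rate budget and serves only queues
whose weight `C k * w k` is maximal. -/
theorem simplexRegion_maxWeight {K : ℕ} {C : Fin K → ℝ} (hC : ∀ k, 0 < C k) {w r : Fin K → ℝ}
    (hr : r ∈ simplexRegion C) (hmax : ∀ q ∈ simplexRegion C, ip q w ≤ ip r w)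
    {m : Fin K} (hm : ∀ k, C k * w k ≤ C m * w m) (hpos : 0 < C m * w m) :
    ∑ k, r k / C k = 1 ∧ ∀ k, 0 < r k → C k * w k = C m * w m := by
  obtain ⟨hr0, hr1⟩ := hr
  have hvertex : C m * w m ≤ ip r w := by
    have hmem : Pi.single m (C m) ∈ simplexRegion C := by
      refine ⟨fun k => ?_, ?_⟩
      · by_cases h : k = m
        · subst h; simpa using (hC k).le
        · simp [h]
      · rw [Finset.sum_eq_single m] <;> simp +contextual [(hC m).ne']
    refine le_of_eq_of_le ?_ (hmax _ hmem)
    unfold ip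
    rw [Finset.sum_eq_single m] <;> simp +contextual
  have hip : ip r w = ∑ k, r k / C k * (C k * w k) :=
    Finset.sum_congr rfl fun k _ => by have := (hC k).ne'; field_simp
  have hterm : ∀ k ∈ Finset.univ, r k / C k * (C k * w k) ≤ r k / C k * (C m * w m) :=
    fun k _ => mul_le_mul_of_nonneg_left (hm k) (div_nonneg (hr0 k) (hC k).le)
  have hle : ip r w ≤ (∑ k, r k / C k) * (C m * w m) := by
    rw [hip, Finset.sum_mul]
    exact Finset.sum_le_sum hterm
  have hone : ∑ k, r k / C k = 1 := by
    refine le_antisymm hr1 ?_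
    by_contra! h
    nlinarith
  refine ⟨hone, fun k hk => ?_⟩
  have heq : ∑ k, r k / C k * (C k * w k) = ∑ k, r k / C k * (C m * w m) := by
    refine le_antisymm (Finset.sum_le_sum hterm) ?_
    rw [← hip, ← Finset.sum_mul, hone, one_mul]
    exact hvertex
  exact mul_left_cancel₀ (div_pos hk (hC k)).ne'
    ((Finset.sum_eq_sum_iff_of_le hterm).1 heq k (Finset.mem_univ k))

/-- The level of total work above which a work-conserving max-weight scheduler wastes no
service. -/
noncomputable def wasteLevel {K : ℕ} (C : Fin K → ℝ) : ℝ := ∑ k, (∑ j, C j) ^ 2 / C k / C k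

theorem wasteLevel_nonneg {K : ℕ} {C : Fin K → ℝ} (hC : ∀ k, 0 < C k) : 0 ≤ wasteLevel C :=
  Finset.sum_nonneg fun k _ => div_nonneg (div_nonneg (sq_nonneg _) (hC k).le) (hC k).le

theorem totalWork_posPart_sub_le {K : ℕ} {C : Fin K → ℝ} (hC : ∀ k, 0 < C k)
    {H : Orth K → Orth K} (hH : IsWCScheduler (simplexRegion C) C H) (w : Orth K) :
    totalWork C (_root_.posPart (w.1 - (H w).1)).1 ≤ max (totalWork C w.1 - 1) (wasteLevel C) := by
  by_cases hsmall : ∀ k, C k * w.1 k ≤ (∑ j, C j) ^ 2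
  · refine le_max_of_le_right (Finset.sum_le_sum fun k _ => ?_)
    refine div_le_div_of_nonneg_right ?_ (hC k).le
    have hw : w.1 k ≤ (∑ j, C j) ^ 2 / C k := by
      rw [le_div_iff₀ (hC k), mul_comm]
      exact hsmall k
    have hH0 := (H w).2 k
    exact max_le ((sub_le_self _ hH0).trans hw) ((w.2 k).trans hw)
  · push Not at hsmall
    obtain ⟨i, hi⟩ := hsmall
    have : Nonempty (Fin K) := ⟨i⟩
    obtain ⟨m, hm⟩ := Finite.exists_max fun k => C k * w.1 k
    have hbig : (∑ j, C j) ^ 2 < C m * w.1 m := hi.trans_le (hm i)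
    have hCS : ∀ k, C k ^ 2 ≤ (∑ j, C j) ^ 2 := fun k =>
      pow_le_pow_left₀ (hC k).le
        (Finset.single_le_sum (fun j _ => (hC j).le) (Finset.mem_univ k)) 2
    have hout : ¬ ∀ k, w.1 k < C k := fun h => by
      have h1 := h m
      have h2 := hC m
      have h3 := hCS m
      nlinarith
    obtain ⟨hmem, hmax⟩ := (hH w).2 hout
    obtain ⟨hone, hserve⟩ := simplexRegion_maxWeight hC hmem hmax hm
      ((sq_nonneg _).trans_lt hbig)
    have hle : ∀ k, (H w).1 k ≤ w.1 k := fun k => by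
      rcases ((H w).2 k).eq_or_lt with h0 | h0
      · rw [← h0]; exact w.2 k
      · have hrC : (H w).1 k ≤ C k := by
          have h : (H w).1 k / C k ≤ ∑ k, (H w).1 k / C k :=
            Finset.single_le_sum (f := fun k => (H w).1 k / C k)
              (fun k _ => div_nonneg ((H w).2 k) (hC k).le) (Finset.mem_univ k)
          rwa [hone, div_le_one (hC k)] at h
        have h1 := hserve k h0
        have h2 := hCS k
        have h3 := hC k
        nlinarith
    refine le_max_of_le_left (le_of_eq ?_)
    rw [← hone]
    unfold totalWork
    rw [← Finset.sum_sub_distrib]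
    refine Finset.sum_congr rfl fun k _ => ?_
    have hk : (_root_.posPart (w.1 - (H w).1)).1 k = w.1 k - (H w).1 k :=
      max_eq_left (sub_nonneg.2 (hle k))
    rw [hk, sub_div]

theorem totalWork_addO {K : ℕ} (C : Fin K → ℝ) (a b : Orth K) :
    totalWork C (addO a b).1 = totalWork C a.1 + totalWork C b.1 := by
  simp [totalWork, addO, add_div, Finset.sum_add_distrib]

/-- If the work arriving in any window of length `t` ending now exceeds `t` by at most `D`,
then every finite-horizon workload is bounded in terms of `D`. -/
theorem totalWork_GwcL_le {K : ℕ} {C : Fin K → ℝ} (hC : ∀ k, 0 < C k)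
    {H : Orth K → Orth K} (hH : IsWCScheduler (simplexRegion C) C H) (T : ℕ)
    (g : ℕ → Orth K) (D : ℝ) (hg : ∀ t : ℕ, ∑ s ∈ Finset.range t, totalWork C (g s).1 ≤ t + D) :
    totalWork C (GwcL H (List.ofFn fun i : Fin T => g i)).1 ≤ D + 1 + wasteLevel C := by
  have hB := wasteLevel_nonneg hC
  induction T generalizing g D with
  | zero =>
    have h := hg 0
    simp only [Finset.range_zero, Finset.sum_empty, Nat.cast_zero] at h
    simp only [List.ofFn_zero, GwcL, totalWork, zero_div, Finset.sum_const_zero]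
    linarith
  | succ T ih =>
    have hfirst : totalWork C (g 0).1 ≤ 1 + D := by simpa using hg 1
    cases T with
    | zero =>
      simp only [List.ofFn_succ, List.ofFn_zero, GwcL]
      simp only [Fin.val_zero]
      linarith
    | succ T =>
      have htail := ih (fun s => g (s + 1)) (D + 1 - totalWork C (g 0).1) fun t => by
        have h := hg (t + 1)
        rw [Finset.sum_range_succ'] at h
        push_cast at h
        linarith
      have hstep := totalWork_posPart_sub_le hC hH
        (GwcL H (List.ofFn fun i : Fin (T + 1) => g (i + 1)))
      have hG : GwcL H (List.ofFn fun i : Fin (T + 1 + 1) => g i) =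
          addO (g 0) (_root_.posPart ((GwcL H (List.ofFn fun i : Fin (T + 1) => g (i + 1))).1 -
            (H (GwcL H (List.ofFn fun i : Fin (T + 1) => g (i + 1)))).1)) := by
        simp only [List.ofFn_succ, GwcL, Fin.val_succ, Fin.val_zero]
      rw [hG, totalWork_addO]
      rcases le_max_iff.1 hstep with h | h <;> linarith

theorem DK.sum_range_le_add_dist {K : ℕ} (a b : DK K) (t : ℕ) (k : Fin K) :
    ∑ s ∈ Finset.range t, a.f s k ≤ ∑ s ∈ Finset.range t, b.f s k + t * dist a b := by
  cases t with
  | zero => simp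
  | succ t =>
    have h : dist (a.emb (t, k)) (b.emb (t, k)) ≤ dist a b :=
      BoundedContinuousFunction.dist_coe_le_dist _
    have h' : (∑ s ∈ Finset.range (t + 1), a.f s k) / ((t : ℝ) + 1) -
        (∑ s ∈ Finset.range (t + 1), b.f s k) / ((t : ℝ) + 1) ≤ dist a b :=
      (le_abs_self _).trans h
    rw [← sub_div, div_le_iff₀ (by positivity)] at h'
    push_cast
    linarith

theorem sum_totalWork {K : ℕ} (C : Fin K → ℝ) (f : ℕ → Fin K → ℝ) (t : ℕ) :
    ∑ s ∈ Finset.range t, totalWork C (f s) = totalWork C fun k => ∑ s ∈ Finset.range t, f s k := by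
  simp only [totalWork, Finset.sum_div]
  exact Finset.sum_comm

/-- For a stable arrival process, the excess of arriving work over service time is bounded
uniformly over a neighbourhood. -/
theorem exists_excess_bound {K : ℕ} {C : Fin K → ℝ} (hC : ∀ k, 0 < C k) {μ : Fin K → ℝ}
    (hμ : ∑ k, μ k / C k < 1) (x : Dmu K μ) :
    ∃ D : ℝ, ∀ᶠ a : Dmu K μ in 𝓝 x,
      ∀ t : ℕ, ∑ s ∈ Finset.range t, totalWork C (a.1.f s) ≤ t + D := by
  obtain ⟨ρ, hρμ, hρ1⟩ := exists_between hμ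
  have hrate : Tendsto
      (fun t : ℕ => totalWork C fun k => (∑ s ∈ Finset.range t, x.1.f s k) / t)
      atTop (𝓝 (∑ k, μ k / C k)) :=
    tendsto_finsetSum _ fun k _ => (x.2 k).div_const _
  have hev : ∀ᶠ t : ℕ in atTop,
      (totalWork C fun k => ∑ s ∈ Finset.range t, x.1.f s k) - ρ * t ≤ 0 := by
    filter_upwards [hrate.eventually_lt_const hρμ, eventually_gt_atTop 0] with t ht ht0
    have ht0' : (0 : ℝ) < t := by exact_mod_cast ht0
    have heq : (totalWork C fun k => (∑ s ∈ Finset.range t, x.1.f s k) / t) =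
        (totalWork C fun k => ∑ s ∈ Finset.range t, x.1.f s k) / t := by
      simp only [totalWork]
      rw [Finset.sum_div]
      exact Finset.sum_congr rfl fun k _ => div_right_comm _ _ _
    rw [heq, div_lt_iff₀ ht0'] at ht
    linarith
  obtain ⟨D, hD⟩ := (isBoundedUnder_of_eventually_le hev).bddAbove_range
  refine ⟨D, ?_⟩
  have hdist : Tendsto (fun a : Dmu K μ => dist a.1 x.1 * ∑ k, 1 / C k) (𝓝 x) (𝓝 0) := by
    have h : Tendsto (fun a : Dmu K μ => dist a x) (𝓝 x) (𝓝 0) :=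
      tendsto_iff_dist_tendsto_zero.1 tendsto_id
    simpa only [zero_mul] using! h.mul_const (∑ k, 1 / C k)
  filter_upwards [hdist.eventually_lt_const (sub_pos.2 hρ1)] with a ha t
  have hx : (totalWork C fun k => ∑ s ∈ Finset.range t, x.1.f s k) - ρ * t ≤ D :=
    hD (Set.mem_range_self t)
  have hax : (totalWork C fun k => ∑ s ∈ Finset.range t, a.1.f s k) ≤
      (totalWork C fun k => ∑ s ∈ Finset.range t, x.1.f s k) +
        t * (dist a.1 x.1 * ∑ k, 1 / C k) := by
    simp only [totalWork, Finset.mul_sum]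
    rw [← Finset.sum_add_distrib]
    refine Finset.sum_le_sum fun k _ => ?_
    refine (div_le_div_of_nonneg_right (a.1.sum_range_le_add_dist x.1 t k) (hC k).le).trans_eq ?_
    ring
  rw [sum_totalWork]
  have ht : (0 : ℝ) ≤ t := t.cast_nonneg
  nlinarith

/-- Every value of `limUnder` is either a genuine limit or one fixed default value. -/
theorem exists_limUnder_default {X : Type*} [TopologicalSpace X] [Nonempty X] :
    ∃ j : X, ∀ g : ℕ → X, Tendsto g atTop (𝓝 (limUnder atTop g)) ∨ limUnder atTop g = j := by
  refine ⟨Classical.epsilon fun _ => False, fun g => ?_⟩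
  by_cases h : ∃ y, Tendsto g atTop (𝓝 y)
  · exact Or.inl (tendsto_nhds_limUnder h)
  · right
    have hfalse : (fun y => map g atTop ≤ 𝓝 y) = fun _ => False :=
      funext fun y => eq_false fun hy => h ⟨y, hy⟩
    unfold limUnder lim
    rw [hfalse]

/-- The infinite-horizon workload map `G^wc : 𝒟^K_μ → ℝ₊^K` is almost
compact with respect to the scaled uniform metric. -/
theorem infinite_horizon_workload_almost_compact
    (K : ℕ) (hK : 1 ≤ K) (C : Fin K → ℝ) (hC : ∀ k, 0 < C k)
    (Hwc : Orth K → Orth K) (hwc : IsWCScheduler (simplexRegion C) C Hwc)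
    (hqc : QuasiContinuous Hwc)
    (μ : Fin K → ℝ) (hμ0 : ∀ k, 0 ≤ μ k) (hμ : ∑ k, μ k / C k < 1) :
    AlmostCompact (fun a : Dmu K μ => Ginf Hwc a) := by
  intro x u hu
  obtain ⟨D, hD⟩ := exists_excess_bound hC hμ x
  obtain ⟨N, hN⟩ := eventually_atTop.1 (hu.eventually hD)
  obtain ⟨j, hj⟩ := exists_limUnder_default (X := Orth K)
  have hmem : ∀ n, (Ginf Hwc (u (n + N))).1 ∈
      Set.Icc (0 : Fin K → ℝ) fun k => max (C k * (D + 1 + wasteLevel C)) (j.1 k) := by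
    refine fun n => ⟨(Ginf Hwc (u (n + N))).2, fun k => ?_⟩
    rcases hj fun T => GwcL Hwc (List.ofFn (restr (u (n + N)).1 T)) with h | h
    · refine le_max_of_le_left (le_of_tendsto
        (((continuous_apply k).comp continuous_subtype_val).tendsto _ |>.comp h)
        (Eventually.of_forall fun T => ?_))
      refine (le_mul_totalWork hC _ k).trans (mul_le_mul_of_nonneg_left ?_ (hC k).le)
      exact totalWork_GwcL_le hC hwc T
        (fun s => ⟨(u (n + N)).1.f s, (u (n + N)).1.nonneg s⟩) D (hN _ (Nat.le_add_left N n))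
    · exact le_max_of_le_right (congrArg (fun w : Orth K => w.1 k) h).le
  obtain ⟨y, hy, φ, hφ, hlim⟩ := isCompact_Icc.tendsto_subseq hmem
  exact ⟨fun n => φ n + N, ⟨y, hy.1⟩, fun a b hab => Nat.add_lt_add_right (hφ hab) N,
    tendsto_subtype_rng.2 hlim⟩
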